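/- For Gaussian distributions $P = N(0, \Sigma_1)$ and $Q = N(0, \Sigma_2)$ on $\mathbb{R}^n$ with $\Sigma_1, \Sigma_2 \succeq I_n$, the KL divergence satisfies $D_{\mathrm{KL}}(P\|Q) \leq \frac{1}{2}\mathrm{tr}((\Sigma_1 - \Sigma_2)^2) = \frac{1}{2}\|\Sigma_1 - \Sigma_2\|_F^2$. -/

import Mathlib

open Matrix MeasureTheory Real

/-- The density of the multivariate Gaussian `N(m, S)` on `ℝ^n` (w.r.t. Lebesgue measure). -/
noncomputable def gaussPdf {n : ℕ} (m : Fin n → ℝ) (S : Matrix (Fin n) (Fin n) ℝ)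
    (x : Fin n → ℝ) : ℝ :=
  ((2 * Real.pi) ^ n * S.det) ^ (-(1 : ℝ) / 2) *
    Real.exp (-((x - m) ⬝ᵥ S⁻¹.mulVec (x - m)) / 2)

open scoped MatrixOrder ComplexOrder Matrix.Norms.L2Operator in
lemma psd_factor {n : ℕ} {Q : Matrix (Fin n) (Fin n) ℝ} (hQ : Q.PosSemidef) :
    ∃ B : Matrix (Fin n) (Fin n) ℝ, Q = Bᴴ * B :=
  CStarAlgebra.nonneg_iff_eq_star_mul_self.mp hQ.nonneg

open ProbabilityTheory in
lemma gm_integrable (k : ℕ) : Integrable (fun t : ℝ => t ^ k * gaussianPDFReal 0 1 t) := by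
  have h := (integrable_rpow_mul_exp_neg_mul_sq (b := 1/2) (by norm_num) (s := (k:ℝ))
    (by have : (0:ℝ) ≤ k := Nat.cast_nonneg k
        linarith)).const_mul ((√(2 * π))⁻¹)
  refine h.congr (Filter.Eventually.of_forall fun t => ?_)
  simp only [gaussianPDFReal, rpow_natCast, NNReal.coe_one, mul_one, sub_zero]
  rw [show -(1/2 : ℝ) * t ^ 2 = -t ^ 2 / 2 by ring]
  ring

open ProbabilityTheory in
lemma gm_integral (k : ℕ) :
    ∫ t : ℝ, t ^ k * gaussianPDFReal 0 1 t = ∫ t, t ^ k ∂(gaussianReal 0 1) := by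
  rw [integral_gaussianReal_eq_integral_smul (by norm_num)]
  simp [mul_comm]

open ProbabilityTheory in
lemma gm0 : ∫ t : ℝ, t ^ 0 * gaussianPDFReal 0 1 t = 1 := by
  rw [gm_integral]; simp

open ProbabilityTheory in
lemma gm1 : ∫ t : ℝ, t ^ 1 * gaussianPDFReal 0 1 t = 0 := by
  rw [gm_integral]; simp

open ProbabilityTheory in
lemma gm2 : ∫ t : ℝ, t ^ 2 * gaussianPDFReal 0 1 t = 1 := by
  rw [gm_integral]
  have h := variance_fun_id_gaussianReal (μ := 0) (v := 1)
  rw [variance_of_integral_eq_zero (by fun_prop) (by simp)] at h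
  simpa using h

open ProbabilityTheory in
/-- The standard Gaussian density. -/
noncomputable def stdPhi {n : ℕ} (y : Fin n → ℝ) : ℝ := ∏ k, gaussianPDFReal 0 1 (y k)

open ProbabilityTheory in
lemma stdPhi_mul {n : ℕ} (i j : Fin n) (y : Fin n → ℝ) : stdPhi y * (y i * y j) =
    ∏ k, (y k ^ ((if k = i then 1 else 0) + (if k = j then 1 else 0)) *
      gaussianPDFReal 0 1 (y k)) := by
  rw [Finset.prod_mul_distrib]
  simp only [pow_add, Finset.prod_mul_distrib, pow_ite, pow_one, pow_zero,
    Finset.prod_ite_eq', Finset.mem_univ, if_true, stdPhi]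
  ring

open ProbabilityTheory in
lemma stdPhi_int {n : ℕ} : Integrable (stdPhi (n := n)) := by
  have := Integrable.fintype_prod (ι := Fin n) (μ := fun _ => (volume : Measure ℝ))
    (f := fun (_ : Fin n) (t : ℝ) => gaussianPDFReal 0 1 t)
    (fun _ => by simpa using gm_integrable 0)
  exact this

open ProbabilityTheory in
lemma stdPhi_integral {n : ℕ} : ∫ y : Fin n → ℝ, stdPhi y = 1 := by
  have := integral_fintype_prod_volume_eq_prod
    (fun (_ : Fin n) (t : ℝ) => gaussianPDFReal 0 1 t)
  have h0 := gm0
  simp only [pow_zero, one_mul] at h0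
  simpa [h0, stdPhi] using this

open ProbabilityTheory in
lemma stdPhi_mul_int {n : ℕ} (i j : Fin n) :
    Integrable (fun y : Fin n → ℝ => stdPhi y * (y i * y j)) := by
  simp_rw [stdPhi_mul]
  exact Integrable.fintype_prod (ι := Fin n) (μ := fun _ => (volume : Measure ℝ))
    (f := fun (k : Fin n) (t : ℝ) => t ^ ((if k = i then 1 else 0) + (if k = j then 1 else 0)) *
      gaussianPDFReal 0 1 t) (fun _ => gm_integrable _)

open ProbabilityTheory in
lemma stdPhi_mul_integral {n : ℕ} (i j : Fin n) :
    ∫ y : Fin n → ℝ, stdPhi y * (y i * y j) = if i = j then 1 else 0 := by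
  simp_rw [stdPhi_mul]
  rw [integral_fintype_prod_volume_eq_prod
    (fun (k : Fin n) (t : ℝ) => t ^ ((if k = i then 1 else 0) + (if k = j then 1 else 0)) *
      gaussianPDFReal 0 1 t)]
  split_ifs with h
  · subst h
    refine Finset.prod_eq_one fun k _ => ?_
    by_cases hk : k = i
    · simpa [hk] using gm2
    · simpa [hk] using gm0
  · refine Finset.prod_eq_zero (Finset.mem_univ i) ?_
    simpa [h] using gm1

lemma quad_integral {n : ℕ} (c : ℝ) (M : Matrix (Fin n) (Fin n) ℝ) :
    ∫ y : Fin n → ℝ, stdPhi y * (c + y ⬝ᵥ M.mulVec y) = c + M.trace := by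
  have e : ∀ y : Fin n → ℝ, stdPhi y * (c + y ⬝ᵥ M.mulVec y) =
      c * stdPhi y + ∑ i, ∑ j, M i j * (stdPhi y * (y i * y j)) := by
    intro y
    simp only [dotProduct, mulVec, mul_add, Finset.mul_sum]
    congr 1
    · ring
    · refine Finset.sum_congr rfl fun i _ => Finset.sum_congr rfl fun j _ => ?_
      ring
  simp_rw [e]
  have hi : ∀ i j, Integrable (fun y : Fin n → ℝ => M i j * (stdPhi y * (y i * y j))) :=
    fun i j => (stdPhi_mul_int i j).const_mul _
  rw [integral_add (stdPhi_int.const_mul c)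
    (integrable_finsetSum _ fun i _ => integrable_finsetSum _ fun j _ => hi i j),
    integral_const_mul, stdPhi_integral,
    integral_finsetSum _ fun i _ => integrable_finsetSum _ fun j _ => hi i j]
  simp_rw [fun i => integral_finsetSum Finset.univ (fun j _ => hi i j), integral_const_mul,
    stdPhi_mul_integral]
  simp [Matrix.trace]

lemma change_var {n : ℕ} (A : Matrix (Fin n) (Fin n) ℝ) (hA : A.det ≠ 0)
    (f : (Fin n → ℝ) → ℝ) :
    ∫ x, f x = |A.det| * ∫ y, f (A.mulVec y) := by
  have h := Real.map_matrix_volume_pi_eq_smul_volume_pi hA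
  have hE : MeasurableEmbedding (toLin' A) := by
    have hinj : Function.Injective (toLin' A) := by
      have := Matrix.mulVec_injective_of_isUnit ((Matrix.isUnit_iff_isUnit_det A).2 hA.isUnit)
      exact fun a b h => this (by simpa only [toLin'_apply] using h)
    exact ((toLin' A).continuous_of_finiteDimensional).measurableEmbedding hinj
  have h2 := hE.integral_map (μ := volume) f
  rw [h, integral_smul_measure] at h2
  simp only [toLin'_apply] at h2
  rw [← h2, ENNReal.toReal_ofReal (abs_nonneg _), smul_eq_mul, ← mul_assoc, ← abs_mul,
    mul_inv_cancel₀ hA]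
  simp

lemma gaussPdf_pos {n : ℕ} {S : Matrix (Fin n) (Fin n) ℝ} (hS : 0 < S.det) (x : Fin n → ℝ) :
    0 < gaussPdf 0 S x := by
  unfold gaussPdf; positivity

lemma log_gaussPdf {n : ℕ} {S : Matrix (Fin n) (Fin n) ℝ} (hS : 0 < S.det) (x : Fin n → ℝ) :
    Real.log (gaussPdf 0 S x) =
      -(1/2) * (Real.log ((2 * π) ^ n) + Real.log S.det) - (x ⬝ᵥ S⁻¹.mulVec x) / 2 := by
  unfold gaussPdf
  rw [Real.log_mul (by positivity) (by positivity), Real.log_rpow (by positivity), Real.log_exp,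
    Real.log_mul (by positivity) (by positivity), sub_zero]
  ring

open ProbabilityTheory in
lemma gaussPdf_mulVec {n : ℕ} (A : Matrix (Fin n) (Fin n) ℝ) (hA : A.det ≠ 0) (y : Fin n → ℝ) :
    |A.det| * gaussPdf 0 (A * Aᵀ) (A.mulVec y) = stdPhi y := by
  have hu : IsUnit A.det := hA.isUnit
  have hq : (A.mulVec y) ⬝ᵥ (A * Aᵀ)⁻¹.mulVec (A.mulVec y) = ∑ k, y k ^ 2 := by
    rw [Matrix.mul_inv_rev, mulVec_mulVec, Matrix.mul_assoc, Matrix.nonsing_inv_mul _ hu,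
      Matrix.mul_one, Matrix.dotProduct_mulVec, ← Matrix.mulVec_transpose,
      Matrix.transpose_nonsing_inv, Matrix.transpose_transpose, mulVec_mulVec,
      Matrix.nonsing_inv_mul _ hu, one_mulVec]
    simp [dotProduct, sq]
  have hd : ((2 * π) ^ n * (A * Aᵀ).det) ^ (-(1 : ℝ) / 2) = (√(2 * π))⁻¹ ^ n * |A.det|⁻¹ := by
    rw [det_mul, det_transpose, show -(1:ℝ)/2 = -(1/2) by ring, Real.rpow_neg (mul_nonneg (by positivity) (mul_self_nonneg _)),
      ← Real.sqrt_eq_rpow, Real.sqrt_mul (by positivity), Real.sqrt_mul_self_eq_abs, mul_inv,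
      inv_pow]
    congr 2
    rw [Real.sqrt_eq_iff_mul_self_eq (by positivity) (by positivity), ← mul_pow,
      Real.mul_self_sqrt (by positivity)]
  have hA' : |A.det| ≠ 0 := abs_ne_zero.2 hA
  unfold gaussPdf stdPhi
  rw [hd, sub_zero, hq]
  simp only [gaussianPDFReal, Finset.prod_mul_distrib, Finset.prod_const, Finset.card_univ,
    Fintype.card_fin, ← Real.exp_sum, NNReal.coe_one, mul_one, sub_zero]
  rw [← Finset.sum_div, Finset.sum_neg_distrib]
  field_simp

lemma trace_mul_nonneg' {n : ℕ} {P Q : Matrix (Fin n) (Fin n) ℝ} (hP : P.PosSemidef)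
    (hQ : Q.PosSemidef) : 0 ≤ (P * Q).trace := by
  obtain ⟨B, rfl⟩ := psd_factor hQ
  rw [← Matrix.mul_assoc, Matrix.trace_mul_comm, ← Matrix.mul_assoc]
  exact (hP.mul_mul_conjTranspose_same B).trace_nonneg

lemma one_sub_inv_psd {n : ℕ} {S : Matrix (Fin n) (Fin n) ℝ} (h : (S - 1).PosSemidef)
    (hS : S.PosDef) : (1 - S⁻¹).PosSemidef := by
  have hu : IsUnit S.det := hS.det_pos.ne'.isUnit
  have hK : ((S - 1) + (S - 1)ᴴ * (S - 1)).PosSemidef :=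
    h.add (Matrix.posSemidef_conjTranspose_mul_self _)
  have := hK.conjTranspose_mul_mul_same S⁻¹
  rw [hS.inv.isHermitian.eq, h.isHermitian.eq] at this
  convert this using 1
  have e : (S - 1) + (S - 1) * (S - 1) = S * (S - 1) := by noncomm_ring
  rw [e, ← Matrix.mul_assoc, Matrix.nonsing_inv_mul _ hu, Matrix.one_mul, Matrix.sub_mul,
    Matrix.mul_nonsing_inv _ hu, Matrix.one_mul]

lemma log_det_le {n : ℕ} {S : Matrix (Fin n) (Fin n) ℝ} (hS : S.PosDef) :
    Real.log S.det ≤ S.trace - n := by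
  rw [hS.isHermitian.det_eq_prod_eigenvalues, hS.isHermitian.trace_eq_sum_eigenvalues]
  simp only [RCLike.ofReal_real_eq_id, id]
  rw [Real.log_prod fun i _ => (hS.eigenvalues_pos i).ne']
  calc _ ≤ ∑ i, (hS.isHermitian.eigenvalues i - 1) :=
        Finset.sum_le_sum fun i _ => Real.log_le_sub_one_of_pos (hS.eigenvalues_pos i)
    _ = _ := by simp

/-- For centered Gaussians with covariances `Σ₁, Σ₂ ⪰ Iₙ`, the KL divergence is bounded by
half the squared Frobenius norm of `Σ₁ - Σ₂`. -/
theorem kl_gaussian_frobenius_bound {n : ℕ} (S1 S2 : Matrix (Fin n) (Fin n) ℝ)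
    (h1 : (S1 - 1).PosSemidef) (h2 : (S2 - 1).PosSemidef) :
    (∫ x : Fin n → ℝ, gaussPdf 0 S1 x * Real.log (gaussPdf 0 S1 x / gaussPdf 0 S2 x))
      ≤ (1 / 2) * Matrix.trace ((S1 - S2) * (S1 - S2))
    ∧ Matrix.trace ((S1 - S2) * (S1 - S2)) = ∑ i, ∑ j, (S1 i j - S2 i j) ^ 2 := by
  have p1 : S1.PosDef := by simpa using Matrix.PosDef.posSemidef_add h1 Matrix.PosDef.one
  have p2 : S2.PosDef := by simpa using Matrix.PosDef.posSemidef_add h2 Matrix.PosDef.one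
  have hDh : (S1 - S2).IsHermitian := p1.isHermitian.sub p2.isHermitian
  have u1 : IsUnit S1.det := p1.det_pos.ne'.isUnit
  have u2 : IsUnit S2.det := p2.det_pos.ne'.isUnit
  constructor
  swap
  · simp only [Matrix.trace, Matrix.diag, Matrix.mul_apply]
    refine Finset.sum_congr rfl fun i _ => Finset.sum_congr rfl fun j _ => ?_
    have := hDh.apply i j
    simp only [star_trivial] at this
    rw [this, Matrix.sub_apply, sq]
  obtain ⟨B, hB⟩ := psd_factor p1.posSemidef
  obtain ⟨A, hA⟩ : ∃ A : Matrix (Fin n) (Fin n) ℝ, S1 = A * Aᵀ :=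
    ⟨Bᵀ, by rw [hB, conjTranspose_eq_transpose_of_trivial, transpose_transpose]⟩
  have dA : A.det ≠ 0 := by
    intro h
    have := p1.det_pos
    rw [hA, det_mul, h] at this
    simp at this
  have key : (∫ x : Fin n → ℝ, gaussPdf 0 S1 x * Real.log (gaussPdf 0 S1 x / gaussPdf 0 S2 x))
      = (1/2) * (Real.log S2.det - Real.log S1.det + (S2⁻¹ * S1).trace - n) := by
    rw [change_var A dA, ← integral_const_mul]
    have e : ∀ y : Fin n → ℝ, |A.det| * (gaussPdf 0 S1 (A.mulVec y) *
        Real.log (gaussPdf 0 S1 (A.mulVec y) / gaussPdf 0 S2 (A.mulVec y))) =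
        stdPhi y * ((1/2) * (Real.log S2.det - Real.log S1.det) +
          y ⬝ᵥ (((1/2 : ℝ) • (Aᵀ * S2⁻¹ * A - 1)).mulVec y)) := by
      intro y
      rw [Real.log_div (gaussPdf_pos p1.det_pos _).ne' (gaussPdf_pos p2.det_pos _).ne',
        log_gaussPdf p1.det_pos, log_gaussPdf p2.det_pos, ← mul_assoc, ← gaussPdf_mulVec A dA y,
        ← hA]
      congr 1
      have q1 : (A.mulVec y) ⬝ᵥ S1⁻¹.mulVec (A.mulVec y) = y ⬝ᵥ y := by
        rw [hA, Matrix.mul_inv_rev, mulVec_mulVec, Matrix.mul_assoc,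
          Matrix.nonsing_inv_mul _ dA.isUnit,
          Matrix.mul_one, Matrix.dotProduct_mulVec, ← Matrix.mulVec_transpose,
          Matrix.transpose_nonsing_inv, Matrix.transpose_transpose, mulVec_mulVec,
          Matrix.nonsing_inv_mul _ dA.isUnit, one_mulVec]
      have q2 : (A.mulVec y) ⬝ᵥ S2⁻¹.mulVec (A.mulVec y) =
          y ⬝ᵥ (Aᵀ * S2⁻¹ * A).mulVec y := by
        rw [← mulVec_mulVec, ← mulVec_mulVec, Matrix.dotProduct_mulVec y, Matrix.vecMul_transpose]
      rw [q1, q2, smul_mulVec, dotProduct_smul, sub_mulVec, dotProduct_sub, one_mulVec,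
        smul_eq_mul]
      ring
    simp_rw [e]
    rw [quad_integral, trace_smul, trace_sub, trace_one, Fintype.card_fin, Matrix.trace_mul_comm,
      ← Matrix.mul_assoc, ← hA, Matrix.trace_mul_comm, smul_eq_mul]
    ring
  rw [key]
  have hlog : Real.log S2.det - Real.log S1.det ≤ (S1⁻¹ * S2).trace - n := by
    have hinj : Function.Injective (A⁻¹ᵀ).mulVec := by
      apply Matrix.mulVec_injective_of_isUnit
      rw [Matrix.isUnit_iff_isUnit_det, det_transpose]
      exact (Matrix.isUnit_nonsing_inv_det _ dA.isUnit)
    have hp := p2.conjTranspose_mul_mul_same hinj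
    rw [conjTranspose_eq_transpose_of_trivial, transpose_transpose] at hp
    have := log_det_le hp
    have ht : (A⁻¹ * S2 * A⁻¹ᵀ).trace = (S1⁻¹ * S2).trace := by
      rw [Matrix.trace_mul_comm, ← Matrix.mul_assoc, hA, Matrix.mul_inv_rev,
        Matrix.transpose_nonsing_inv]
    have hd : (A⁻¹ * S2 * A⁻¹ᵀ).det = S2.det / S1.det := by
      rw [det_mul, det_mul, det_transpose, det_nonsing_inv, hA, det_mul, det_transpose,
        Ring.inverse_eq_inv']
      field_simp
    rw [ht, hd, Real.log_div p2.det_pos.ne' p1.det_pos.ne'] at this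
    exact this
  have hexp : (S1⁻¹ * ((S1 - S2) * S2⁻¹ * (S1 - S2))).trace =
      (S1⁻¹ * S2).trace + (S2⁻¹ * S1).trace - 2 * n := by
    have : S1⁻¹ * ((S1 - S2) * S2⁻¹ * (S1 - S2)) =
        (S1⁻¹ * S1) * (S2⁻¹ * S1) - (S1⁻¹ * S1) * (S2⁻¹ * S2) - S1⁻¹ * (S2 * S2⁻¹) * S1
        + S1⁻¹ * (S2 * S2⁻¹) * S2 := by noncomm_ring
    rw [this, Matrix.nonsing_inv_mul _ u1, Matrix.nonsing_inv_mul _ u2,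
      Matrix.mul_nonsing_inv _ u2]
    simp only [Matrix.mul_one, Matrix.one_mul]
    rw [Matrix.nonsing_inv_mul _ u1, trace_add, trace_sub, trace_sub, trace_one, Fintype.card_fin]
    ring
  have t1 : 0 ≤ ((1 - S1⁻¹) * ((S1 - S2) * S2⁻¹ * (S1 - S2))).trace := by
    apply trace_mul_nonneg' (one_sub_inv_psd h1 p1)
    have := p2.inv.posSemidef.mul_mul_conjTranspose_same (S1 - S2)
    rwa [hDh.eq] at this
  have t2 : 0 ≤ ((1 - S2⁻¹) * ((S1 - S2) * (S1 - S2))).trace := by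
    apply trace_mul_nonneg' (one_sub_inv_psd h2 p2)
    have := Matrix.posSemidef_conjTranspose_mul_self (S1 - S2)
    rwa [hDh.eq] at this
  have t3 : ((S1 - S2) * S2⁻¹ * (S1 - S2)).trace = (S2⁻¹ * ((S1 - S2) * (S1 - S2))).trace := by
    rw [Matrix.mul_assoc, Matrix.trace_mul_comm, Matrix.mul_assoc]
  rw [Matrix.sub_mul, Matrix.one_mul, trace_sub] at t1 t2
  linarith
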